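/- arXiv:2402.04950 — 8 statements merged into one kernel-verified Lean document; each statement's English description precedes it below -/
import Mathlib

section
/- Let λ ∈ ℂ with λ = ik for some k ∈ ℤ, and let h : ℝ → ℂ be smooth and 2π-periodic with ∫₀^{2π} e^{λs} h(s) ds = 0. Then the function y(t) = e^{−λt} ∫₀^t e^{λs} h(s) ds is 2π-periodic and satisfies y'(t) + λ y(t) = h(t) for all t ∈ ℝ. -/
/-- If `c T ∈ 2πiℤ`, then `t ↦ e^{ct}` is `T`-periodic. -/
theorem Complex.periodic_exp_mul_ofReal {c : ℂ} {T : ℝ} {n : ℤ}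
    (hc : c * T = n * (2 * Real.pi * Complex.I)) :
    Function.Periodic (fun t : ℝ => Complex.exp (c * t)) T := by
  intro t
  simp only [Complex.ofReal_add, mul_add, hc]
  exact Complex.exp_periodic.int_mul n (c * t)

/-- A primitive of a periodic function with zero mean is periodic. -/
theorem Function.Periodic.periodic_intervalIntegral_of_eq_zero {E : Type*}
    [NormedAddCommGroup E] [NormedSpace ℝ E] {f : ℝ → E} {T : ℝ}
    (hf : Function.Periodic f T) (hfc : Continuous f) (h0 : (∫ s in (0 : ℝ)..T, f s) = 0) :
    Function.Periodic (fun t => ∫ s in (0 : ℝ)..t, f s) T := by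
  intro t
  simp only [hf.intervalIntegral_add_eq_add 0 t (fun a b => hfc.intervalIntegrable a b),
    zero_add, h0, add_zero]

/-- Variation of constants: the Duhamel integral solves `y' + c y = h`. -/
theorem hasDerivAt_exp_neg_mul_integral (c : ℂ) {h : ℝ → ℂ} (hc : Continuous h) (t : ℝ) :
    HasDerivAt
      (fun t : ℝ => Complex.exp (-(c * t)) * ∫ s in (0 : ℝ)..t, Complex.exp (c * s) * h s)
      (h t - c * (Complex.exp (-(c * t)) * ∫ s in (0 : ℝ)..t, Complex.exp (c * s) * h s)) t := by
  have hcont : Continuous fun s : ℝ => Complex.exp (c * s) * h s := by fun_prop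
  have hI := hcont.integral_hasStrictDerivAt 0 t |>.hasDerivAt
  have hE : HasDerivAt (fun t : ℝ => Complex.exp (-(c * t)))
      (Complex.exp (-(c * t)) * -(c * 1)) t :=
    ((Complex.ofRealCLM.hasDerivAt (x := t)).const_mul c).neg.cexp
  refine (hE.mul hI).congr_deriv ?_
  have hexp : Complex.exp (-(c * t)) * Complex.exp (c * t) = 1 := by
    rw [← Complex.exp_add, neg_add_cancel, Complex.exp_zero]
  linear_combination h t * hexp

/-- Resonant case of Lemma 3.2: if `λ = ik` with `k ∈ ℤ` and `h` is smooth `2π`-periodic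
with `∫₀^{2π} e^{λs} h(s) ds = 0`, then `y(t) = e^{-λt} ∫₀^t e^{λs} h(s) ds` is a
`2π`-periodic solution of `y' + λy = h`. -/
theorem stmt2 (lam : ℂ) (k : ℤ) (hlam : lam = Complex.I * k)
    (h : ℝ → ℂ) (hsm : ContDiff ℝ (⊤ : ℕ∞) h) (hper : Function.Periodic h (2 * Real.pi))
    (hint : (∫ s in (0:ℝ)..(2 * Real.pi), Complex.exp (lam * s) * h s) = 0)
    (y : ℝ → ℂ)
    (hy : ∀ t : ℝ, y t = Complex.exp (-(lam * t)) * ∫ s in (0:ℝ)..t, Complex.exp (lam * s) * h s) :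
    Function.Periodic y (2 * Real.pi) ∧ ∀ t : ℝ, deriv y t + lam * y t = h t := by
  obtain rfl : y = _ := funext hy
  constructor
  · have hexp : Function.Periodic (fun t : ℝ => Complex.exp (lam * t)) (2 * Real.pi) :=
      Complex.periodic_exp_mul_ofReal (n := k) (by rw [hlam]; push_cast; ring)
    have hexp_neg : Function.Periodic (fun t : ℝ => Complex.exp (-lam * t)) (2 * Real.pi) :=
      Complex.periodic_exp_mul_ofReal (n := -k) (by rw [hlam]; push_cast; ring)
    have hcont : Continuous fun s : ℝ => Complex.exp (lam * s) * h s := by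
      have := hsm.continuous
      fun_prop
    have hprim := (hexp.mul hper).periodic_intervalIntegral_of_eq_zero hcont hint
    simp only [neg_mul] at hexp_neg
    exact hexp_neg.mul hprim
  · intro t
    rw [(hasDerivAt_exp_neg_mul_integral lam hsm.continuous t).deriv]
    ring
end

section
/- Let c : ℝ → ℂ be smooth and 2π-periodic with average c₀, let C(t) = ∫₀^t c(τ) dτ − c₀ t, let μ ∈ ℝ and q ∈ ℂ with μc₀ − iq ∉ ℤ, and let f : ℝ → ℂ be smooth and 2π-periodic. Then the equation u'(t) + i(μ c(t) − iq) u(t) = f(t) has exactly one 2π-periodic differentiable solution u : ℝ → ℂ, and it is given by u(t) = (1 − e^{−2πi(μc₀ − iq)})⁻¹ ∫₀^{2π} e^{−qτ} e^{−iμ(c₀τ − C(t−τ) + C(t))} f(t − τ) dτ. -/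
/-- The primitive `A` of a coefficient turns the convolution-type integral over a period into
an integral of `e^A f` over the preceding period. -/
theorem integral_exp_primitive_sub (A f : ℝ → ℂ) (T t : ℝ) :
    ∫ τ in (0:ℝ)..T, Complex.exp (-(A t - A (t - τ))) * f (t - τ) =
      Complex.exp (-A t) * ∫ s in (t - T)..t, Complex.exp (A s) * f s := by
  have h := intervalIntegral.integral_comp_sub_left (a := 0) (b := T)
    (fun s => Complex.exp (A s) * f s) t
  rw [sub_zero] at h
  rw [← h, ← intervalIntegral.integral_const_mul]
  congr 1
  ext τ
  rw [← mul_assoc, ← Complex.exp_add]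
  ring_nf

/-- A `T`-periodic solution of `u' + a u = f` is given by an integral over one period. -/
theorem periodic_solution_eq {a A f u : ℝ → ℂ} {T : ℝ} {L : ℂ}
    (hA : ∀ t, HasDerivAt A (a t) t) (hAT : ∀ t, A (t + T) = A t + L)
    (hL : Complex.exp (-L) ≠ 1) (hf : Continuous f) (hu : Differentiable ℝ u)
    (hper : Function.Periodic u T) (heq : ∀ t, deriv u t + a t * u t = f t) (t : ℝ) :
    u t = (1 - Complex.exp (-L))⁻¹ *
      ∫ τ in (0:ℝ)..T, Complex.exp (-(A t - A (t - τ))) * f (t - τ) := by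
  have hAc : Continuous A := continuous_iff_continuousAt.2 fun t => (hA t).continuousAt
  have hderiv (s : ℝ) : HasDerivAt (fun s => Complex.exp (A s) * u s)
      (Complex.exp (A s) * f s) s := by
    refine ((hA s).cexp.mul (hu s).hasDerivAt).congr_deriv ?_
    rw [← heq s]
    ring
  have hint := intervalIntegral.integral_eq_sub_of_hasDerivAt (a := t - T) (b := t)
    (fun s _ => hderiv s) ((hAc.cexp.mul hf).intervalIntegrable _ _)
  have hAt : A (t - T) = A t + -L := by
    have h := hAT (t - T)
    rw [sub_add_cancel] at h
    rw [h]
    ring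
  have h1 : 1 - Complex.exp (-L) ≠ 0 := sub_ne_zero.2 hL.symm
  rw [integral_exp_primitive_sub, hint, hper.sub_eq, hAt, Complex.exp_add,
    eq_inv_mul_iff_mul_eq₀ h1, Complex.exp_neg (A t)]
  field_simp [Complex.exp_ne_zero (A t)]

/-- The integral over one period defines a `T`-periodic solution of `u' + a u = f`. -/
theorem exists_periodic_solution {a A f : ℝ → ℂ} {T : ℝ} {L : ℂ}
    (hA : ∀ t, HasDerivAt A (a t) t) (hAT : ∀ t, A (t + T) = A t + L)
    (hL : Complex.exp (-L) ≠ 1) (hf : Continuous f) (hfper : Function.Periodic f T) :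
    ∃ u : ℝ → ℂ, Differentiable ℝ u ∧ Function.Periodic u T ∧
      ∀ t, deriv u t + a t * u t = f t := by
  have hAc : Continuous A := continuous_iff_continuousAt.2 fun t => (hA t).continuousAt
  have h1 : 1 - Complex.exp (-L) ≠ 0 := sub_ne_zero.2 hL.symm
  have hgc : Continuous fun s => Complex.exp (A s) * f s := hAc.cexp.mul hf
  set u : ℝ → ℂ := fun t => (1 - Complex.exp (-L))⁻¹ *
    ∫ τ in (0:ℝ)..T, Complex.exp (-(A t - A (t - τ))) * f (t - τ) with hu
  have hderiv (t : ℝ) : HasDerivAt u (f t - a t * u t) t := by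
    have hG (x : ℝ) : HasDerivAt (fun y => ∫ s in (0:ℝ)..y, Complex.exp (A s) * f s)
        (Complex.exp (A x) * f x) x := hgc.integral_hasStrictDerivAt 0 x |>.hasDerivAt
    have hsub : u = fun t => (1 - Complex.exp (-L))⁻¹ * (Complex.exp (-A t) *
        ((∫ s in (0:ℝ)..t, Complex.exp (A s) * f s) -
          ∫ s in (0:ℝ)..(t - T), Complex.exp (A s) * f s)) := by
      ext x
      simp only [hu]
      rw [integral_exp_primitive_sub, intervalIntegral.integral_interval_sub_left
        (hgc.intervalIntegrable _ _) (hgc.intervalIntegrable _ _)]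
    have hAt : A (t - T) = A t + -L := by
      have h := hAT (t - T)
      rw [sub_add_cancel] at h
      rw [h]
      ring
    rw [hsub]
    refine (((hA t).neg.cexp.mul ((hG t).sub
      ((hG (t - T)).comp_sub_const t T))).const_mul _).congr_deriv ?_
    simp only [Pi.neg_apply, Pi.sub_apply]
    rw [hfper.sub_eq, hAt, Complex.exp_add, Complex.exp_neg (A t)]
    field_simp [Complex.exp_ne_zero (A t)]
    ring
  refine ⟨u, fun t => (hderiv t).differentiableAt, fun t => ?_, fun t => ?_⟩
  · simp only [hu]
    congr 2
    ext τ
    rw [add_sub_right_comm, hAT, hAT, hfper, add_sub_add_right_eq_sub]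
  · rw [(hderiv t).deriv]
    ring

/-- `e^{-2πiz} = 1` only for integers `z`. -/
theorem exp_neg_two_pi_I_mul_ne_one {z : ℂ} (hz : ∀ k : ℤ, z ≠ k) :
    Complex.exp (-((2 * Real.pi : ℂ) * Complex.I * z)) ≠ 1 := by
  rw [Ne, Complex.exp_eq_one_iff]
  rintro ⟨n, hn⟩
  apply hz (-n)
  apply mul_left_cancel₀ Complex.two_pi_I_ne_zero
  push_cast
  linear_combination -hn


/-- Solution formula (3.7): if `μc₀ - iq ∉ ℤ`, the equation `u' + i(μc(t) - iq)u = f` has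
exactly one `2π`-periodic differentiable solution, given by
`u(t) = (1 - e^{-2πi(μc₀ - iq)})⁻¹ ∫₀^{2π} e^{-qτ} e^{-iμ(c₀τ - C(t-τ) + C(t))} f(t-τ) dτ`. -/
theorem stmt4 (c : ℝ → ℂ) (hc : ContDiff ℝ (⊤ : ℕ∞) c) (hper : Function.Periodic c (2 * Real.pi))
    (c0 : ℂ) (hc0 : c0 = (1 / (2 * Real.pi) : ℂ) * ∫ τ in (0:ℝ)..(2 * Real.pi), c τ)
    (C : ℝ → ℂ) (hC : ∀ t : ℝ, C t = (∫ τ in (0:ℝ)..t, c τ) - c0 * t)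
    (μ : ℝ) (q : ℂ) (hnr : ∀ k : ℤ, (μ : ℂ) * c0 - Complex.I * q ≠ k)
    (f : ℝ → ℂ) (hf : ContDiff ℝ (⊤ : ℕ∞) f) (hfper : Function.Periodic f (2 * Real.pi)) :
    (∃! u : ℝ → ℂ, Differentiable ℝ u ∧ Function.Periodic u (2 * Real.pi) ∧
        ∀ t : ℝ, deriv u t + Complex.I * ((μ : ℂ) * c t - Complex.I * q) * u t = f t) ∧
    (∀ u : ℝ → ℂ, (Differentiable ℝ u ∧ Function.Periodic u (2 * Real.pi) ∧
        ∀ t : ℝ, deriv u t + Complex.I * ((μ : ℂ) * c t - Complex.I * q) * u t = f t) →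
      ∀ t : ℝ,
        u t = (1 - Complex.exp (-((2 * Real.pi : ℂ) * Complex.I *
                ((μ : ℂ) * c0 - Complex.I * q))))⁻¹ *
          ∫ τ in (0:ℝ)..(2 * Real.pi), Complex.exp (-(q * τ)) *
            Complex.exp (-(Complex.I * (μ : ℂ) * (c0 * τ - C (t - τ) + C t))) * f (t - τ)) := by
  set A : ℝ → ℂ := fun t => Complex.I * μ * (∫ τ in (0:ℝ)..t, c τ) + q * t with hAdef
  have hcc : Continuous c := hc.continuous
  have hA (t : ℝ) : HasDerivAt A (Complex.I * ((μ : ℂ) * c t - Complex.I * q)) t := by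
    refine (((hcc.integral_hasStrictDerivAt 0 t).hasDerivAt.const_mul (Complex.I * (μ : ℂ))).add
      ((Complex.ofRealCLM.hasDerivAt (x := t)).const_mul q)).congr_deriv ?_
    simp only [Complex.ofRealCLM_apply, Complex.ofReal_one]
    linear_combination q * Complex.I_mul_I
  have hmean : ∫ τ in (0:ℝ)..(2 * Real.pi), c τ = 2 * Real.pi * c0 := by
    have hpi : (Real.pi : ℂ) ≠ 0 := Complex.ofReal_ne_zero.2 Real.pi_ne_zero
    rw [hc0]
    field_simp
  have hAT (t : ℝ) : A (t + 2 * Real.pi) =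
      A t + (2 * Real.pi : ℂ) * Complex.I * ((μ : ℂ) * c0 - Complex.I * q) := by
    simp only [hAdef]
    rw [← intervalIntegral.integral_add_adjacent_intervals (hcc.intervalIntegrable 0 t)
      (hcc.intervalIntegrable t _), hper.intervalIntegral_add_eq t 0, zero_add, hmean]
    push_cast
    linear_combination (2 * Real.pi * q) * Complex.I_mul_I
  have hL := exp_neg_two_pi_I_mul_ne_one hnr
  have hform (u : ℝ → ℂ) (hu : Differentiable ℝ u ∧ Function.Periodic u (2 * Real.pi) ∧
      ∀ t : ℝ, deriv u t + Complex.I * ((μ : ℂ) * c t - Complex.I * q) * u t = f t) (t : ℝ) :=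
    periodic_solution_eq hA hAT hL hf.continuous hu.1 hu.2.1 hu.2.2 t
  obtain ⟨u, hu⟩ := exists_periodic_solution hA hAT hL hf.continuous hfper
  refine ⟨⟨u, hu, fun v hv => funext fun t => (hform v hv t).trans (hform u hu t).symm⟩,
    fun v hv t => ?_⟩
  rw [hform v hv t]
  congr 2
  ext τ
  rw [← Complex.exp_add]
  congr 2
  simp only [hAdef, hC]
  push_cast
  ring
end

section
/- Let c : ℝ → ℂ be smooth and 2π-periodic with average c₀, let C(t) = ∫₀^t c(τ) dτ − c₀ t, let μ ∈ ℝ and q ∈ ℂ with μc₀ − iq ∉ ℤ, and let f : ℝ → ℂ be smooth and 2π-periodic. Then the unique 2π-periodic solution u of u'(t) + i(μ c(t) − iq) u(t) = f(t) is also given by u(t) = (e^{2πi(μc₀ − iq)} − 1)⁻¹ ∫₀^{2π} e^{qτ} e^{−iμ(−c₀τ − C(t+τ) + C(t))} f(t + τ) dτ. -/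
open intervalIntegral in
/-- Variation of constants over one period for `u' + a u = f`, where `A` is a primitive of `a` and
`A` increases by `m` over the period `T`. -/
theorem eq_integral_of_periodic_of_deriv_add_mul {a A f u : ℝ → ℂ} {T : ℝ} {m : ℂ}
    (hA : ∀ t, HasDerivAt A (a t) t) (hAT : ∀ t, A (t + T) = A t + m) (hm : Complex.exp m ≠ 1)
    (hf : Continuous f) (hu : Differentiable ℝ u) (huT : Function.Periodic u T)
    (hode : ∀ t, deriv u t + a t * u t = f t) (t : ℝ) :
    u t = (Complex.exp m - 1)⁻¹ * ∫ τ in (0 : ℝ)..T, Complex.exp (A (t + τ) - A t) * f (t + τ) := by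
  have hAc : Continuous A := continuous_iff_continuousAt.2 fun s => (hA s).continuousAt
  have hderiv : ∀ τ : ℝ, HasDerivAt (fun τ => Complex.exp (A (t + τ) - A t) * u (t + τ))
      (Complex.exp (A (t + τ) - A t) * f (t + τ)) τ := by
    intro τ
    have hA' := (((hA (t + τ)).comp_const_add t τ).sub_const (A t)).cexp
    have hu' := (hu (t + τ)).hasDerivAt.comp_const_add t τ
    refine (hA'.mul hu').congr_deriv ?_
    rw [← hode (t + τ)]
    ring
  have hint := integral_eq_sub_of_hasDerivAt (a := 0) (b := T) (fun τ _ => hderiv τ)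
    (Continuous.intervalIntegrable (by fun_prop) _ _)
  rw [hint, hAT, huT t, add_zero, add_sub_cancel_left, sub_self, Complex.exp_zero]
  field_simp [sub_ne_zero.2 hm]

open intervalIntegral in
theorem exists_periodic_deriv_add_mul_eq {a A f : ℝ → ℂ} {T : ℝ} {m : ℂ}
    (hA : ∀ t, HasDerivAt A (a t) t) (hAT : ∀ t, A (t + T) = A t + m) (hm : Complex.exp m ≠ 1)
    (hf : Continuous f) (hfT : Function.Periodic f T) :
    ∃ u : ℝ → ℂ, Differentiable ℝ u ∧ Function.Periodic u T ∧
      ∀ t, deriv u t + a t * u t = f t := by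
  have hAc : Continuous A := continuous_iff_continuousAt.2 fun s => (hA s).continuousAt
  have hc : Continuous fun s => Complex.exp (A s) * f s := by fun_prop
  have hi : ∀ x y : ℝ, IntervalIntegrable (fun s => Complex.exp (A s) * f s)
    MeasureTheory.volume x y := fun x y => hc.intervalIntegrable x y
  set G : ℝ → ℂ := fun t => ∫ s in (0 : ℝ)..t, Complex.exp (A s) * f s with hG
  have hG' : ∀ t, HasDerivAt G (Complex.exp (A t) * f t) t := fun t =>
    integral_hasDerivAt_right (hi _ _) (hc.stronglyMeasurableAtFilter _ _) hc.continuousAt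
  have hGT : ∀ t, G (t + T) = G T + Complex.exp m * G t := by
    intro t
    have h : (∫ s in T..t + T, Complex.exp (A s) * f s) = Complex.exp m * G t := by
      have := integral_comp_add_right (a := 0) (b := t) (fun s => Complex.exp (A s) * f s) T
      rw [zero_add] at this
      rw [← this, hG, ← integral_const_mul]
      refine integral_congr fun s _ => ?_
      simp only [hAT, hfT s, Complex.exp_add]
      ring
    rw [← h]
    exact (integral_add_adjacent_intervals (hi _ _) (hi _ _)).symm
  have hu : ∀ t, HasDerivAt
      (fun t => Complex.exp (-A t) * ((Complex.exp m - 1)⁻¹ * G T + G t))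
      (Complex.exp (-A t) * -a t * ((Complex.exp m - 1)⁻¹ * G T + G t) +
        Complex.exp (-A t) * (Complex.exp (A t) * f t)) t := fun t =>
    (hA t).fun_neg.cexp.mul ((hG' t).const_add _)
  refine ⟨_, fun t => (hu t).differentiableAt, fun t => ?_, fun t => ?_⟩
  · have h1 := sub_ne_zero.2 hm
    have h2 := Complex.exp_ne_zero m
    simp only [hAT, hGT, neg_add, Complex.exp_add, Complex.exp_neg m]
    field_simp
    ring
  · rw [(hu t).deriv, ← mul_assoc (Complex.exp (-A t)) (Complex.exp (A t)), ← Complex.exp_add,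
      neg_add_cancel, Complex.exp_zero]
    ring


/-- Alternative solution formula (3.8): if `μc₀ - iq ∉ ℤ`, any `2π`-periodic differentiable
solution `u` of `u' + i(μc(t) - iq)u = f` is given by
`u(t) = (e^{2πi(μc₀ - iq)} - 1)⁻¹ ∫₀^{2π} e^{qτ} e^{-iμ(-c₀τ - C(t+τ) + C(t))} f(t+τ) dτ`. -/
theorem stmt5 (c : ℝ → ℂ) (hc : ContDiff ℝ (⊤ : ℕ∞) c) (hper : Function.Periodic c (2 * Real.pi))
    (c0 : ℂ) (hc0 : c0 = (1 / (2 * Real.pi) : ℂ) * ∫ τ in (0:ℝ)..(2 * Real.pi), c τ)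
    (C : ℝ → ℂ) (hC : ∀ t : ℝ, C t = (∫ τ in (0:ℝ)..t, c τ) - c0 * t)
    (μ : ℝ) (q : ℂ) (hnr : ∀ k : ℤ, (μ : ℂ) * c0 - Complex.I * q ≠ k)
    (f : ℝ → ℂ) (hf : ContDiff ℝ (⊤ : ℕ∞) f) (hfper : Function.Periodic f (2 * Real.pi)) :
    (∃! u : ℝ → ℂ, Differentiable ℝ u ∧ Function.Periodic u (2 * Real.pi) ∧
        ∀ t : ℝ, deriv u t + Complex.I * ((μ : ℂ) * c t - Complex.I * q) * u t = f t) ∧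
    (∀ u : ℝ → ℂ, (Differentiable ℝ u ∧ Function.Periodic u (2 * Real.pi) ∧
        ∀ t : ℝ, deriv u t + Complex.I * ((μ : ℂ) * c t - Complex.I * q) * u t = f t) →
      ∀ t : ℝ,
        u t = (Complex.exp ((2 * Real.pi : ℂ) * Complex.I * ((μ : ℂ) * c0 - Complex.I * q)) - 1)⁻¹ *
          ∫ τ in (0:ℝ)..(2 * Real.pi), Complex.exp (q * τ) *
            Complex.exp (-(Complex.I * (μ : ℂ) * (-(c0 * τ) - C (t + τ) + C t))) * f (t + τ)) := by
  have hcc := hc.continuous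
  have hpi : (Real.pi : ℂ) ≠ 0 := Complex.ofReal_ne_zero.2 Real.pi_ne_zero
  set A : ℝ → ℂ := fun t => Complex.I * μ * (∫ τ in (0 : ℝ)..t, c τ) + q * t with hAdef
  have hA : ∀ t, HasDerivAt A (Complex.I * ((μ : ℂ) * c t - Complex.I * q)) t := by
    intro t
    have h1 : HasDerivAt (fun t : ℝ => ∫ τ in (0 : ℝ)..t, c τ) (c t) t :=
      intervalIntegral.integral_hasDerivAt_right (hcc.intervalIntegrable _ _)
        (hcc.stronglyMeasurableAtFilter _ _) hcc.continuousAt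
    refine ((h1.const_mul (Complex.I * μ)).add
      ((Complex.ofRealCLM.hasDerivAt (x := t)).const_mul q)).congr_deriv ?_
    simp only [Complex.ofRealCLM_apply, Complex.ofReal_one]
    linear_combination q * Complex.I_mul_I
  have hAT : ∀ t, A (t + 2 * Real.pi) =
      A t + (2 * Real.pi : ℂ) * Complex.I * ((μ : ℂ) * c0 - Complex.I * q) := by
    intro t
    have h2 : (∫ τ in (0 : ℝ)..(2 * Real.pi), c τ) = 2 * Real.pi * c0 := by
      rw [hc0]; field_simp
    have h3 : (∫ τ in (0 : ℝ)..(t + 2 * Real.pi), c τ) =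
        (∫ τ in (0 : ℝ)..t, c τ) + 2 * Real.pi * c0 := by
      rw [← h2, ← intervalIntegral.integral_add_adjacent_intervals (b := t)
        (hcc.intervalIntegrable _ _) (hcc.intervalIntegrable _ _),
        hper.intervalIntegral_add_eq t 0, zero_add]
    simp only [hAdef, h3]
    push_cast
    linear_combination 2 * Real.pi * q * Complex.I_mul_I
  have hm : Complex.exp ((2 * Real.pi : ℂ) * Complex.I * ((μ : ℂ) * c0 - Complex.I * q)) ≠ 1 := by
    rw [Ne, Complex.exp_eq_one_iff]
    rintro ⟨k, hk⟩
    refine hnr k (mul_left_cancel₀ Complex.two_pi_I_ne_zero ?_)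
    rw [hk, mul_comm]
  obtain ⟨v, hv⟩ := exists_periodic_deriv_add_mul_eq hA hAT hm hf.continuous hfper
  refine ⟨⟨v, hv, fun w hw => funext fun t => ?_⟩, fun u hu t => ?_⟩
  · rw [eq_integral_of_periodic_of_deriv_add_mul hA hAT hm hf.continuous hw.1 hw.2.1 hw.2.2 t,
      eq_integral_of_periodic_of_deriv_add_mul hA hAT hm hf.continuous hv.1 hv.2.1 hv.2.2 t]
  · rw [eq_integral_of_periodic_of_deriv_add_mul hA hAT hm hf.continuous hu.1 hu.2.1 hu.2.2 t]
    congr 1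
    refine intervalIntegral.integral_congr fun τ _ => ?_
    simp only [← Complex.exp_add, hC, hAdef]
    congr 2
    push_cast
    ring
end

section
/- Let g : ℝ → ℂ be smooth and 2π-periodic. For every β ∈ ℕ there exists a constant C_β > 0 (depending only on β and g) such that for every μ ∈ ℝ satisfying μ·Im g(t) ≤ 0 for all t ∈ ℝ, and every t ∈ ℝ, the β-th derivative of the function t ↦ e^{−iμ g(t)} satisfies |dᵝ/dtᵝ e^{−iμ g(t)}| ≤ C_β (1 + |μ|)^β. -/
theorem Function.Periodic.iteratedDeriv {𝕜 F : Type*} [NontriviallyNormedField 𝕜]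
    [NormedAddCommGroup F] [NormedSpace 𝕜 F] {f : 𝕜 → F} {c : 𝕜}
    (hf : Function.Periodic f c) (n : ℕ) : Function.Periodic (iteratedDeriv n f) c := fun t ↦ by
  rw [← congrFun (iteratedDeriv_comp_add_const n f c) t, funext hf]

/-- The real derivatives of a smooth periodic function up to a given order are uniformly
bounded. -/
theorem Function.Periodic.exists_norm_iteratedDeriv_le {F : Type*} [NormedAddCommGroup F]
    [NormedSpace ℝ F] {f : ℝ → F} {c : ℝ} (hf : Function.Periodic f c) (hc : c ≠ 0) {n : ℕ}
    (hf' : ContDiff ℝ n f) :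
    ∃ M : ℝ, 1 ≤ M ∧ ∀ i ≤ n, ∀ t, ‖_root_.iteratedDeriv i f t‖ ≤ M := by
  have h : ∀ i : ℕ, ∃ B : ℝ, i ≤ n → ∀ t, ‖_root_.iteratedDeriv i f t‖ ≤ B := fun i ↦ by
    by_cases hi : i ≤ n
    · obtain ⟨B, hB⟩ := ((hf.iteratedDeriv i).isBounded_of_continuous hc
        (hf'.continuous_iteratedDeriv i (by exact_mod_cast hi))).exists_norm_le
      exact ⟨B, fun _ t ↦ hB _ (Set.mem_range_self t)⟩
    · exact ⟨0, fun h ↦ absurd h hi⟩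
  choose B hB using h
  obtain ⟨M, hM⟩ := ((Finset.range (n + 1)).image B).bddAbove
  refine ⟨max 1 M, le_max_left _ _, fun i hi t ↦ (hB i hi t).trans (le_max_of_le_right ?_)⟩
  exact hM (Finset.mem_coe.2 (Finset.mem_image_of_mem B (Finset.mem_range_succ_iff.2 hi)))

theorem Complex.norm_iteratedFDeriv_exp (n : ℕ) (z : ℂ) :
    ‖iteratedFDeriv ℝ n Complex.exp z‖ =
      Real.exp z.re * ‖iteratedFDeriv ℝ n Complex.exp 0‖ := by
  have h := iteratedFDeriv_comp_add_left (𝕜 := ℝ) (f := Complex.exp) n z 0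
  have hexp : (fun w ↦ Complex.exp (z + w)) = fun w ↦ Complex.exp z • Complex.exp w := by
    ext w
    rw [Complex.exp_add, smul_eq_mul]
  rw [hexp, iteratedFDeriv_const_smul_apply' Complex.contDiff_exp.contDiffAt, add_zero] at h
  rw [← h, norm_smul, Complex.norm_exp]


/-- Faà di Bruno estimate: for `g` smooth `2π`-periodic and every `β ∈ ℕ` there is
`C_β > 0` such that whenever `μ · Im g(t) ≤ 0` for all `t`, the `β`-th derivative of
`t ↦ e^{-iμg(t)}` is bounded by `C_β (1 + |μ|)^β`. -/
theorem stmt7 (g : ℝ → ℂ) (hg : ContDiff ℝ (⊤ : ℕ∞) g) (hper : Function.Periodic g (2 * Real.pi))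
    (β : ℕ) :
    ∃ Cβ : ℝ, 0 < Cβ ∧ ∀ μ : ℝ, (∀ t : ℝ, μ * (g t).im ≤ 0) → ∀ t : ℝ,
      ‖iteratedDeriv β (fun s : ℝ => Complex.exp (-(Complex.I * (μ : ℂ) * g s))) t‖ ≤
        Cβ * (1 + |μ|) ^ β := by
  obtain ⟨M, hM1, hM⟩ := hper.exists_norm_iteratedDeriv_le Real.two_pi_pos.ne'
    (hg.of_le (by exact_mod_cast le_top) : ContDiff ℝ β g)
  set K : ℝ := 1 + ∑ i ∈ Finset.range (β + 1), ‖iteratedFDeriv ℝ i Complex.exp 0‖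
  have hK0 : 0 < K := by positivity
  refine ⟨β.factorial * K * M ^ β, by positivity, fun μ hμ t ↦ ?_⟩
  have hD : 1 ≤ M * (1 + |μ|) := one_le_mul_of_one_le_of_one_le hM1 (by simp)
  have hg' : ContDiff ℝ β (fun s ↦ -(Complex.I * (μ : ℂ)) * g s) :=
    contDiff_const.mul (hg.of_le (by exact_mod_cast le_top))
  have key := norm_iteratedFDeriv_comp_le (𝕜 := ℝ) (g := Complex.exp) (C := K)
    (D := M * (1 + |μ|)) Complex.contDiff_exp hg' le_rfl t ?_ ?_
  · rw [norm_iteratedFDeriv_eq_norm_iteratedDeriv, mul_pow, ← mul_assoc] at key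
    simpa only [Function.comp_def, neg_mul] using key
  · intro i hi
    have hre : (-(Complex.I * (μ : ℂ)) * g t).re ≤ 0 := by simpa using hμ t
    rw [Complex.norm_iteratedFDeriv_exp]
    refine (mul_le_of_le_one_left (norm_nonneg _) (Real.exp_le_one_iff.2 hre)).trans ?_
    have := Finset.single_le_sum (f := fun i ↦ ‖iteratedFDeriv ℝ i Complex.exp 0‖)
      (fun _ _ ↦ norm_nonneg _) (Finset.mem_range_succ_iff.2 hi)
    linarith
  · intro i hi hiβ
    rw [norm_iteratedFDeriv_eq_norm_iteratedDeriv, iteratedDeriv_const_mul_field, norm_mul]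
    calc ‖-(Complex.I * (μ : ℂ))‖ * ‖iteratedDeriv i g t‖ ≤ (1 + |μ|) * M := by
          gcongr
          · simp
          · exact hM i hiβ t
      _ = M * (1 + |μ|) := mul_comm _ _
      _ ≤ (M * (1 + |μ|)) ^ i := le_self_pow₀ hD (by omega)
end

section
/- Let c = a + ib : ℝ → ℂ be smooth and 2π-periodic (a, b real-valued) with average c₀, let μ ∈ ℝ and q ∈ ℂ with μc₀ − iq ∈ ℤ. Let m = min_{t ∈ [0,2π]} ∫₀^t (Re q − μ b(s)) ds, attained at some t* ∈ [0, 2π], and define u(t) = e^m · exp(−∫₀^t (iμ c(s) + q) ds). Then u is 2π-periodic, satisfies u'(t) + i(μ c(t) − iq) u(t) = 0 for all t, |u(t)| ≤ 1 for all t ∈ ℝ, and |u(t*)| = 1. -/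
/-- The exponential of minus a primitive of a continuous periodic function, whose integral over one
period is an integer multiple of `2πi`, is periodic. -/
theorem periodic_cexp_neg_integral {g : ℝ → ℂ} {T : ℝ} (hg : Continuous g)
    (hgp : Function.Periodic g T) (k : ℤ)
    (hk : ∫ s in (0:ℝ)..T, g s = k * (2 * Real.pi * Complex.I)) :
    Function.Periodic (fun t : ℝ => Complex.exp (-∫ s in (0:ℝ)..t, g s)) T := by
  intro t
  have h : ∫ s in (0:ℝ)..(t + T), g s = (∫ s in (0:ℝ)..t, g s) + k * (2 * Real.pi * Complex.I) := by
    rw [← intervalIntegral.integral_add_adjacent_intervals (hg.intervalIntegrable 0 t)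
      (hg.intervalIntegrable t (t + T)), hgp.intervalIntegral_add_eq t 0, zero_add, hk]
  simp only [h]
  rw [neg_add, ← sub_eq_add_neg, Complex.exp_periodic.sub_int_mul_eq]

/-- The normalized homogeneous solution from Case (i) of Proposition 4.1: if
`μc₀ - iq ∈ ℤ` then `u(t) = e^m exp(-∫₀^t (iμc(s) + q) ds)`, with
`m = min_{[0,2π]} ∫₀^t (Re q - μ b(s)) ds` attained at `t*`, is `2π`-periodic, solves the
homogeneous equation, satisfies `|u| ≤ 1` everywhere and `|u(t*)| = 1`. -/
theorem stmt12 (a b : ℝ → ℝ) (ha : ContDiff ℝ (⊤ : ℕ∞) a) (hb : ContDiff ℝ (⊤ : ℕ∞) b)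
    (hap : Function.Periodic a (2 * Real.pi)) (hbp : Function.Periodic b (2 * Real.pi))
    (c : ℝ → ℂ) (hc : ∀ t : ℝ, c t = (a t : ℂ) + Complex.I * (b t : ℂ))
    (c0 : ℂ) (hc0 : c0 = (1 / (2 * Real.pi) : ℂ) * ∫ τ in (0:ℝ)..(2 * Real.pi), c τ)
    (μ : ℝ) (q : ℂ) (k : ℤ) (hres : (μ : ℂ) * c0 - Complex.I * q = k)
    (tstar : ℝ) (htstar : tstar ∈ Set.Icc (0:ℝ) (2 * Real.pi))
    (hmin : ∀ t ∈ Set.Icc (0:ℝ) (2 * Real.pi),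
      (∫ s in (0:ℝ)..tstar, (q.re - μ * b s)) ≤ ∫ s in (0:ℝ)..t, (q.re - μ * b s))
    (m : ℝ) (hm : m = ∫ s in (0:ℝ)..tstar, (q.re - μ * b s))
    (u : ℝ → ℂ)
    (hu : ∀ t : ℝ, u t = (Real.exp m : ℂ) *
        Complex.exp (-∫ s in (0:ℝ)..t, (Complex.I * (μ : ℂ) * c s + q))) :
    Function.Periodic u (2 * Real.pi) ∧
    (∀ t : ℝ, deriv u t + Complex.I * ((μ : ℂ) * c t - Complex.I * q) * u t = 0) ∧
    (∀ t : ℝ, ‖u t‖ ≤ 1) ∧ ‖u tstar‖ = 1 := by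
  have hcc : Continuous c := by
    have hac := ha.continuous
    have hbc := hb.continuous
    rw [funext hc]
    fun_prop
  have hcp : Function.Periodic c (2 * Real.pi) := fun t => by rw [hc, hc, hap t, hbp t]
  set g : ℝ → ℂ := fun s => Complex.I * (μ : ℂ) * c s + q with hgdef
  have hg : Continuous g := by fun_prop
  have hgp : Function.Periodic g (2 * Real.pi) := fun t => by simp only [hgdef, hcp t]
  have hint : ∫ s in (0:ℝ)..(2 * Real.pi), g s = k * (2 * Real.pi * Complex.I) := by
    have hpi : (Real.pi : ℂ) ≠ 0 := Complex.ofReal_ne_zero.mpr Real.pi_ne_zero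
    have hci : ∫ τ in (0:ℝ)..(2 * Real.pi), c τ = 2 * Real.pi * c0 := by
      rw [hc0]
      field_simp
    have hcI : IntervalIntegrable (fun s => Complex.I * (μ : ℂ) * c s) MeasureTheory.volume
        0 (2 * Real.pi) := Continuous.intervalIntegrable (by fun_prop) _ _
    rw [intervalIntegral.integral_add hcI intervalIntegrable_const,
      intervalIntegral.integral_const_mul, hci, intervalIntegral.integral_const, ← hres,
      Complex.real_smul]
    push_cast
    linear_combination (2 * Real.pi * q) * Complex.I_sq
  have hper : Function.Periodic u (2 * Real.pi) := fun t => by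
    rw [hu, hu]
    exact congrArg _ (periodic_cexp_neg_integral hg hgp k hint t)
  have hnorm : ∀ t, ‖u t‖ = Real.exp (m - ∫ s in (0:ℝ)..t, (q.re - μ * b s)) := fun t => by
    have hre : (∫ s in (0:ℝ)..t, g s).re = ∫ s in (0:ℝ)..t, (q.re - μ * b s) := by
      have h := Complex.reCLM.intervalIntegral_comp_comm
        (hg.intervalIntegrable (μ := MeasureTheory.volume) 0 t)
      simp only [Complex.reCLM_apply] at h
      rw [← h]
      congr 1 with s
      simp [hgdef, hc]
      ring
    rw [hu, norm_mul, Complex.norm_real, Real.norm_of_nonneg (Real.exp_pos m).le,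
      Complex.norm_exp, Complex.neg_re, hre, ← Real.exp_add, sub_eq_add_neg]
  refine ⟨hper, fun t => ?_, fun t => ?_, ?_⟩
  · have hd : HasDerivAt u ((Real.exp m : ℂ) *
        (Complex.exp (-∫ s in (0:ℝ)..t, g s) * -g t)) t := by
      rw [funext hu]
      exact ((hg.integral_hasStrictDerivAt 0 t).hasDerivAt.neg.cexp).const_mul _
    rw [hd.deriv, hu]
    simp only [hgdef]
    linear_combination (-(Real.exp m : ℂ) * Complex.exp (-∫ s in (0:ℝ)..t, g s) * q) * Complex.I_sq
  · obtain ⟨y, hy, hty⟩ := hper.exists_mem_Ico₀ Real.two_pi_pos t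
    rw [hty, hnorm, Real.exp_le_one_iff, hm]
    exact sub_nonpos.mpr (hmin y ⟨hy.1, hy.2.le⟩)
  · rw [hnorm, hm, sub_self, Real.exp_zero]
end

section
/- Let c : ℝ → ℂ be smooth and 2π-periodic with average c₀, let μ ∈ ℝ, q ∈ ℂ, t* ∈ ℝ, and let φ : ℝ → ℂ be continuous. For t ∈ [0, 2π] define u(t) = exp(−i∫_{t*}^t (μ c(w) − iq) dw) · [ ∫₀^t φ(s) ds + e^{−2πi(μc₀ − iq)} ∫_t^{2π} φ(s) ds ]. Then u satisfies u'(t) + i(μ c(t) − iq) u(t) = (1 − e^{−2πi(μc₀ − iq)}) exp(−i∫_{t*}^t (μ c(w) − iq) dw) φ(t) for all t ∈ (0, 2π), and u(0) = u(2π). -/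
/-- The explicit solution identity (4.3) from Case (ii) of Proposition 4.1. -/
theorem stmt13 (c : ℝ → ℂ) (hc : ContDiff ℝ (⊤ : ℕ∞) c) (hper : Function.Periodic c (2 * Real.pi))
    (c0 : ℂ) (hc0 : c0 = (1 / (2 * Real.pi) : ℂ) * ∫ τ in (0:ℝ)..(2 * Real.pi), c τ)
    (μ : ℝ) (q : ℂ) (tstar : ℝ) (φ : ℝ → ℂ) (hφ : Continuous φ)
    (u : ℝ → ℂ)
    (hu : ∀ t : ℝ, u t =
        Complex.exp (-(Complex.I * ∫ w in tstar..t, ((μ : ℂ) * c w - Complex.I * q))) *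
          ((∫ s in (0:ℝ)..t, φ s) +
            Complex.exp (-((2 * Real.pi : ℂ) * Complex.I * ((μ : ℂ) * c0 - Complex.I * q))) *
              ∫ s in t..(2 * Real.pi), φ s)) :
    (∀ t ∈ Set.Ioo (0:ℝ) (2 * Real.pi),
      deriv u t + Complex.I * ((μ : ℂ) * c t - Complex.I * q) * u t =
        (1 - Complex.exp (-((2 * Real.pi : ℂ) * Complex.I * ((μ : ℂ) * c0 - Complex.I * q)))) *
          Complex.exp (-(Complex.I * ∫ w in tstar..t, ((μ : ℂ) * c w - Complex.I * q))) *
            φ t) ∧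
    u 0 = u (2 * Real.pi) := by
  have hg : Continuous fun w : ℝ => (μ : ℂ) * c w - Complex.I * q := by
    have := hc.continuous
    fun_prop
  have hE (t : ℝ) : HasDerivAt
      (fun t : ℝ => Complex.exp (-(Complex.I * ∫ w in tstar..t, ((μ : ℂ) * c w - Complex.I * q))))
      (Complex.exp (-(Complex.I * ∫ w in tstar..t, ((μ : ℂ) * c w - Complex.I * q))) *
        -(Complex.I * ((μ : ℂ) * c t - Complex.I * q))) t :=
    ((hg.integral_hasStrictDerivAt tstar t).hasDerivAt.const_mul Complex.I).neg.cexp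
  constructor
  · intro t _
    have hleft : HasDerivAt (fun t => ∫ s in (0:ℝ)..t, φ s) (φ t) t :=
      (hφ.integral_hasStrictDerivAt 0 t).hasDerivAt
    have hright : HasDerivAt (fun t => ∫ s in t..(2 * Real.pi), φ s) (-φ t) t :=
      intervalIntegral.integral_hasDerivAt_left (hφ.intervalIntegrable _ _)
        (hφ.stronglyMeasurableAtFilter _ _) hφ.continuousAt
    have hderiv := (hE t).mul (hleft.add (hright.const_mul
      (Complex.exp (-((2 * Real.pi : ℂ) * Complex.I * ((μ : ℂ) * c0 - Complex.I * q))))))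
    rw [(hderiv.congr_of_eventuallyEq (Filter.Eventually.of_forall hu)).deriv, hu t]
    simp only [Pi.add_apply]
    ring
  · have hpi : (Real.pi : ℂ) ≠ 0 := by exact_mod_cast Real.pi_ne_zero
    have hperiod : ∫ w in (0:ℝ)..(2 * Real.pi), ((μ : ℂ) * c w - Complex.I * q) =
        2 * Real.pi * ((μ : ℂ) * c0 - Complex.I * q) := by
      rw [intervalIntegral.integral_sub
        ((hc.continuous.intervalIntegrable _ _).const_mul _)
        intervalIntegrable_const, intervalIntegral.integral_const_mul,
        intervalIntegral.integral_const, hc0, Complex.real_smul]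
      push_cast
      field_simp
      ring
    have hsplit := intervalIntegral.integral_add_adjacent_intervals
      (hg.intervalIntegrable (μ := MeasureTheory.volume) tstar 0)
      (hg.intervalIntegrable 0 (2 * Real.pi))
    rw [hu, hu, ← hsplit, hperiod, intervalIntegral.integral_same, intervalIntegral.integral_same,
      zero_add, mul_zero, add_zero, ← mul_assoc, ← Complex.exp_add]
    congr 2
    ring
end

section
/- There exists a constant c > 0 such that for every z ∈ ℂ, min(|1 − e^{2πiz}|, |1 − e^{−2πiz}|) ≥ c · min(1, dist(z, ℤ)), where dist(z, ℤ) = inf_{k ∈ ℤ} |z − k|. -/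
theorem Complex.sq_norm_one_sub_exp (w : ℂ) :
    ‖1 - Complex.exp w‖ ^ 2 =
      (1 - Real.exp w.re) ^ 2 + 2 * Real.exp w.re * (1 - Real.cos w.im) := by
  rw [Complex.sq_norm, Complex.normSq_apply]
  simp only [Complex.sub_re, Complex.sub_im, Complex.one_re, Complex.one_im,
    Complex.exp_re, Complex.exp_im]
  linear_combination Real.exp w.re ^ 2 * Real.sin_sq_add_cos_sq w.im

theorem Complex.min_one_norm_le_norm_one_sub_exp {w : ℂ} (hw : |w.im| ≤ Real.pi) :
    1 / 4 * min 1 ‖w‖ ≤ ‖1 - Complex.exp w‖ := by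
  refine le_of_sq_le_sq ?_ (norm_nonneg _)
  rw [Complex.sq_norm_one_sub_exp, mul_pow]
  have hcos : 1 / 8 * w.im ^ 2 ≤ 1 - Real.cos w.im := by
    have h := Real.cos_le_one_sub_mul_cos_sq hw
    have hpi : 1 / 8 ≤ 2 / Real.pi ^ 2 := by
      rw [div_le_div_iff₀ (by norm_num) (by positivity)]
      nlinarith [Real.pi_le_four, Real.pi_pos]
    nlinarith [sq_nonneg w.im]
  have hr := Real.exp_pos w.re
  have hmin : 0 ≤ min 1 ‖w‖ := le_min zero_le_one (norm_nonneg _)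
  rcases lt_or_ge (Real.exp w.re) (1 / 2) with hlt | hge
  · nlinarith [min_le_left 1 ‖w‖, mul_nonneg hr.le (sub_nonneg.2 (Real.cos_le_one w.im))]
  · have hre : 1 / 4 * w.re ^ 2 ≤ (1 - Real.exp w.re) ^ 2 := by
      have h₁ := Real.add_one_le_exp w.re
      rcases le_total 0 w.re with ha | ha
      · nlinarith
      · have h₂ := Real.add_one_le_exp (-w.re)
        have h₃ : Real.exp w.re * Real.exp (-w.re) = 1 := by
          rw [← Real.exp_add, add_neg_cancel, Real.exp_zero]
        have h₄ : -w.re / 2 ≤ 1 - Real.exp w.re := by nlinarith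
        nlinarith
    have hsq : min 1 ‖w‖ ^ 2 ≤ w.re ^ 2 + w.im ^ 2 := by
      calc min 1 ‖w‖ ^ 2 ≤ ‖w‖ ^ 2 := pow_le_pow_left₀ hmin (min_le_right _ _) 2
        _ = w.re ^ 2 + w.im ^ 2 := by rw [Complex.sq_norm, Complex.normSq_apply]; ring
    nlinarith [sq_nonneg w.re, sq_nonneg w.im, Real.cos_le_one w.im]

/-- Lower bound comparing `|1 - e^{±2πiz}|` with the distance of `z` to the integers. -/
theorem stmt14 :
    ∃ c : ℝ, 0 < c ∧ ∀ z : ℂ,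
      c * min 1 (⨅ k : ℤ, ‖z - (k : ℂ)‖) ≤
        min ‖1 - Complex.exp ((2 * Real.pi : ℂ) * Complex.I * z)‖
          ‖1 - Complex.exp (-((2 * Real.pi : ℂ) * Complex.I * z))‖ := by
  refine ⟨1 / 4, by norm_num, fun z => ?_⟩
  set k : ℤ := round z.re
  set w : ℂ := (2 * Real.pi : ℂ) * Complex.I * (z - k) with hw
  have him : w.im = 2 * Real.pi * (z.re - k) := by simp [hw]
  have hw_im : |w.im| ≤ Real.pi := by
    rw [him, abs_mul, abs_of_pos Real.two_pi_pos]
    nlinarith [abs_sub_round z.re, Real.pi_pos]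
  have hnorm : ‖z - k‖ ≤ ‖w‖ := by
    have : ‖w‖ = 2 * Real.pi * ‖z - k‖ := by
      simp [hw, abs_of_pos Real.pi_pos]
    nlinarith [norm_nonneg (z - k), Real.pi_gt_three]
  have hinf : (⨅ j : ℤ, ‖z - (j : ℂ)‖) ≤ ‖w‖ :=
    (ciInf_le ⟨0, by rintro _ ⟨j, rfl⟩; exact norm_nonneg _⟩ k).trans hnorm
  have hexp : Complex.exp ((2 * Real.pi : ℂ) * Complex.I * z) = Complex.exp w :=
    Complex.exp_eq_exp_iff_exists_int.2 ⟨k, by rw [hw]; ring⟩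
  have hle : 1 / 4 * min 1 (⨅ j : ℤ, ‖z - (j : ℂ)‖) ≤ 1 / 4 * min 1 ‖w‖ := by gcongr
  rw [Complex.exp_neg, hexp, ← Complex.exp_neg]
  refine hle.trans (le_min (Complex.min_one_norm_le_norm_one_sub_exp hw_im) ?_)
  simpa using Complex.min_one_norm_le_norm_one_sub_exp (w := -w) (by simpa using hw_im)
end

section
/- Let c₀, q ∈ ℂ, let I be a set, let μ : I → ℝ and ω : I → ℝ with ω(i) ≥ 1 for all i ∈ I, and suppose there is K > 0 with |μ(i)| ≤ K ω(i) for all i ∈ I. Then the following are equivalent: (1) there exist C, M > 0 such that |k + c₀ μ(i) − iq| ≥ C (|k| + ω(i))^{−M} for all k ∈ ℤ and i ∈ I with k + c₀ μ(i) − iq ≠ 0; (2) there exist C, M > 0 such that |1 − e^{2πi(c₀ μ(i) − iq)}| ≥ C ω(i)^{−M} and |1 − e^{−2πi(c₀ μ(i) − iq)}| ≥ C ω(i)^{−M} for all i ∈ I with c₀ μ(i) − iq ∉ ℤ. -/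
/-- The exponential separates a real number from `0` at least linearly, up to saturation. -/
theorem min_one_abs_le_two_mul_abs_one_sub_exp (s : ℝ) :
    min 1 |s| ≤ 2 * |1 - Real.exp s| := by
  rcases le_total 0 s with hs | hs
  · have h := Real.add_one_le_exp s
    rw [abs_of_nonneg hs, abs_of_nonpos (by linarith)]
    exact (min_le_right _ _).trans (by linarith)
  · have h := Real.add_one_le_exp (-s)
    have hpos := Real.exp_pos s
    have hmul : Real.exp s * Real.exp (-s) = 1 := by rw [← Real.exp_add]; simp
    have hone : Real.exp s ≤ 1 := Real.exp_le_one_iff.mpr hs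
    rw [abs_of_nonpos hs, abs_of_nonneg (by linarith)]
    rcases le_total 1 (-s) with h1 | h1
    · exact (min_le_left _ _).trans (by nlinarith)
    · exact (min_le_right _ _).trans (by nlinarith)

/-- In the strip `|Re w| ≤ 1 / 2`, the function `1 - exp (2πiw)` vanishes at most linearly. -/
theorem min_one_norm_le_three_mul_norm_one_sub_exp {w : ℂ} (hw : |w.re| ≤ 1 / 2) :
    min 1 ‖w‖ ≤ 3 * ‖1 - Complex.exp ((2 * Real.pi : ℂ) * Complex.I * w)‖ := by
  have hπ := Real.pi_gt_three
  set r : ℝ := Real.exp (-(2 * Real.pi * w.im)) with hr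
  set u : ℂ := Complex.exp (Complex.I * ((2 * Real.pi * w.re : ℝ) : ℂ)) with hu
  have hexp : Complex.exp ((2 * Real.pi : ℂ) * Complex.I * w) = r * u := by
    rw [hr, hu, Complex.ofReal_exp, ← Complex.exp_add]
    congr 1
    apply Complex.ext <;> simp
  have hu1 : ‖u‖ = 1 := by
    rw [hu, mul_comm, Complex.norm_exp_ofReal_mul_I]
  have hr0 : 0 < r := Real.exp_pos _
  rw [hexp]
  set a : ℝ := ‖1 - (r : ℂ) * u‖
  have hradial : |1 - r| ≤ a := by
    have h := abs_norm_sub_norm_le (1 : ℂ) ((r : ℂ) * u)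
    rwa [norm_mul, hu1, norm_one, mul_one, Complex.norm_real, Real.norm_of_nonneg hr0.le] at h
  have hangular : ‖u - 1‖ ≤ 2 * a := by
    have h : u - 1 = (1 - (r : ℂ)) * u - (1 - (r : ℂ) * u) := by ring
    calc ‖u - 1‖ ≤ ‖(1 - (r : ℂ)) * u‖ + a := by rw [h]; exact norm_sub_le _ _
      _ = |1 - r| + a := by
        rw [norm_mul, hu1, mul_one, ← Complex.ofReal_one, ← Complex.ofReal_sub,
          Complex.norm_real, Real.norm_eq_abs]
      _ ≤ 2 * a := by linarith
  have hre : 2 * |w.re| ≤ a := by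
    have hjordan := Real.mul_abs_le_abs_sin (x := Real.pi * w.re) (by
      rw [abs_mul, abs_of_pos Real.pi_pos]; nlinarith)
    rw [abs_mul, abs_of_pos Real.pi_pos, ← mul_assoc, div_mul_cancel₀ _ Real.pi_ne_zero]
      at hjordan
    have hsin : ‖u - 1‖ = 2 * |Real.sin (Real.pi * w.re)| := by
      rw [hu, Complex.norm_exp_I_mul_ofReal_sub_one, Real.norm_eq_abs, abs_mul, abs_two]
      congr 3
      ring
    linarith
  have him : min 1 |w.im| ≤ 2 * a := by
    have h := min_one_abs_le_two_mul_abs_one_sub_exp (-(2 * Real.pi * w.im))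
    rw [abs_neg, abs_mul, abs_of_pos (by positivity : 0 < 2 * Real.pi)] at h
    have hle : |w.im| ≤ 2 * Real.pi * |w.im| := by nlinarith [abs_nonneg w.im]
    exact (min_le_min_left 1 hle).trans (h.trans (by linarith))
  have hnorm := Complex.norm_le_abs_re_add_abs_im w
  have ha := norm_nonneg (1 - (r : ℂ) * u)
  rcases le_total 1 |w.im| with h | h
  · rw [min_eq_left h] at him
    exact (min_le_left _ _).trans (by linarith)
  · rw [min_eq_right h] at him
    exact (min_le_right _ _).trans (by linarith)

/-- `exp (2πiz)` is unchanged when an integer is added to `z`. -/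
theorem exp_two_pi_I_mul_intCast_add (k : ℤ) (z : ℂ) :
    Complex.exp ((2 * Real.pi : ℂ) * Complex.I * (k + z)) =
      Complex.exp ((2 * Real.pi : ℂ) * Complex.I * z) := by
  rw [mul_add, Complex.exp_add, mul_comm _ (k : ℂ), Complex.exp_int_mul_two_pi_mul_I, one_mul]

/-- Near `0`, `1 - exp (2πiw)` is at most linear in `w`. -/
theorem min_norm_one_sub_exp_le (w : ℂ) :
    min 1 ‖1 - Complex.exp ((2 * Real.pi : ℂ) * Complex.I * w)‖ ≤ 16 * ‖w‖ := by
  have hn : ‖(2 * Real.pi : ℂ) * Complex.I * w‖ = 2 * Real.pi * ‖w‖ := by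
    simp [abs_of_pos Real.pi_pos]
  have hπ := Real.pi_lt_four
  rcases le_total ‖(2 * Real.pi : ℂ) * Complex.I * w‖ 1 with h | h
  · refine (min_le_right _ _).trans ?_
    rw [norm_sub_rev]
    exact (Complex.norm_exp_sub_one_le h).trans (by nlinarith [norm_nonneg w])
  · exact (min_le_left _ _).trans (by nlinarith [norm_nonneg w])


/-- Lemma 3.3: equivalence of the two Diophantine conditions for a family `μ(i)` with
weights `ω(i) ≥ 1` satisfying `|μ(i)| ≤ K ω(i)`. -/
theorem stmt16 (c0 q : ℂ) (ι : Type*) (μ : ι → ℝ) (ω : ι → ℝ)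
    (hω : ∀ i, 1 ≤ ω i) (K : ℝ) (hK : 0 < K) (hμω : ∀ i, |μ i| ≤ K * ω i) :
    (∃ C : ℝ, 0 < C ∧ ∃ M : ℝ, 0 < M ∧
        ∀ (k : ℤ) (i : ι), (k : ℂ) + c0 * (μ i : ℂ) - Complex.I * q ≠ 0 →
          C * ((|(k : ℝ)| + ω i) ^ (-M)) ≤ ‖(k : ℂ) + c0 * (μ i : ℂ) - Complex.I * q‖) ↔
      (∃ C : ℝ, 0 < C ∧ ∃ M : ℝ, 0 < M ∧
        ∀ i : ι, (∀ k : ℤ, c0 * (μ i : ℂ) - Complex.I * q ≠ k) →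
          C * (ω i ^ (-M)) ≤
              ‖1 - Complex.exp ((2 * Real.pi : ℂ) * Complex.I *
                (c0 * (μ i : ℂ) - Complex.I * q))‖ ∧
            C * (ω i ^ (-M)) ≤
              ‖1 - Complex.exp (-((2 * Real.pi : ℂ) * Complex.I *
                (c0 * (μ i : ℂ) - Complex.I * q)))‖) := by
  have hsplit : ∀ (k : ℤ) (i : ι), (k : ℂ) + c0 * (μ i : ℂ) - Complex.I * q =
      k + (c0 * (μ i : ℂ) - Complex.I * q) := fun k i => by ring
  simp only [hsplit]
  set z : ι → ℂ := fun i => c0 * (μ i : ℂ) - Complex.I * q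
  have hzω : ∀ i, ‖z i‖ ≤ (‖c0‖ * K + ‖q‖) * ω i := fun i => by
    calc ‖z i‖ ≤ ‖c0 * (μ i : ℂ)‖ + ‖Complex.I * q‖ := norm_sub_le _ _
      _ = ‖c0‖ * |μ i| + ‖q‖ := by simp
      _ ≤ ‖c0‖ * (K * ω i) + ‖q‖ * ω i := by
        gcongr
        · exact hμω i
        · exact le_mul_of_one_le_right (norm_nonneg _) (hω i)
      _ = (‖c0‖ * K + ‖q‖) * ω i := by ring
  constructor
  · rintro ⟨C, hC, M, hM, h⟩
    set B : ℝ := ‖c0‖ * K + ‖q‖ + 2 with hB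
    have hBpos : 0 < B := by positivity
    refine ⟨min 1 (C * B ^ (-M)) / 3, by positivity, M, hM, fun i hi => ?_⟩
    have hωi : 0 < ω i := zero_lt_one.trans_le (hω i)
    obtain ⟨k, hk⟩ : ∃ k : ℤ, |(k : ℝ) + (z i).re| ≤ 1 / 2 :=
      ⟨-round (z i).re, by
        have h := abs_sub_round (z i).re
        push_cast
        rwa [neg_add_eq_sub]⟩
    have hne : (k : ℂ) + z i ≠ 0 := fun h0 => hi (-k) (by
      push_cast
      exact eq_neg_of_add_eq_zero_right h0)
    have hkω : |(k : ℝ)| + ω i ≤ B * ω i := by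
      have h1 : |(k : ℝ)| ≤ |(k : ℝ) + (z i).re| + |(z i).re| := by
        simpa using abs_sub ((k : ℝ) + (z i).re) (z i).re
      have h2 := Complex.abs_re_le_norm (z i)
      have h3 := hzω i
      have h4 := hω i
      rw [hB]
      linarith
    have hlower : min 1 (C * B ^ (-M)) * ω i ^ (-M) ≤ min 1 ‖(k : ℂ) + z i‖ := by
      refine le_min ?_ ?_
      · exact mul_le_one₀ (min_le_left _ _) (by positivity)
          (Real.rpow_le_one_of_one_le_of_nonpos (hω i) (by linarith))
      · calc min 1 (C * B ^ (-M)) * ω i ^ (-M) ≤ C * B ^ (-M) * ω i ^ (-M) := by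
              gcongr
              exact min_le_right _ _
          _ = C * (B * ω i) ^ (-M) := by
              rw [Real.mul_rpow hBpos.le hωi.le, mul_assoc]
          _ ≤ C * (|(k : ℝ)| + ω i) ^ (-M) := by
              gcongr C * ?_
              exact Real.rpow_le_rpow_of_nonpos (by positivity) hkω (by linarith)
          _ ≤ _ := h k i hne
    have hpos := min_one_norm_le_three_mul_norm_one_sub_exp (w := (k : ℂ) + z i) (by simpa using hk)
    have hneg := min_one_norm_le_three_mul_norm_one_sub_exp (w := -((k : ℂ) + z i)) (by
      rw [Complex.neg_re, abs_neg]
      simpa using hk)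
    rw [exp_two_pi_I_mul_intCast_add] at hpos
    rw [norm_neg, mul_neg, Complex.exp_neg, exp_two_pi_I_mul_intCast_add,
      ← Complex.exp_neg] at hneg
    constructor <;> linarith
  · rintro ⟨C, hC, M, hM, h⟩
    refine ⟨min 1 C / 16, by positivity, M, hM, fun k i hne => ?_⟩
    have hωi : 0 < ω i := zero_lt_one.trans_le (hω i)
    have hbase : ω i ≤ |(k : ℝ)| + ω i := by linarith [abs_nonneg (k : ℝ)]
    have hle_one : (|(k : ℝ)| + ω i) ^ (-M) ≤ 1 :=
      Real.rpow_le_one_of_one_le_of_nonpos ((hω i).trans hbase) (by linarith)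
    have hprod_le_one : min 1 C * (|(k : ℝ)| + ω i) ^ (-M) ≤ 1 :=
      mul_le_one₀ (min_le_left _ _) (by positivity) hle_one
    by_cases hi : ∀ m : ℤ, z i ≠ m
    · have hexp := (h i hi).1
      have hupper := min_norm_one_sub_exp_le ((k : ℂ) + z i)
      rw [exp_two_pi_I_mul_intCast_add] at hupper
      have hlower : min 1 C * (|(k : ℝ)| + ω i) ^ (-M) ≤ C * ω i ^ (-M) :=
        mul_le_mul (min_le_right _ _)
          (Real.rpow_le_rpow_of_nonpos hωi hbase (by linarith)) (by positivity) hC.le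
      have := (le_min hprod_le_one (hlower.trans hexp)).trans hupper
      linarith
    · push Not at hi
      obtain ⟨m, hm⟩ := hi
      change (k : ℂ) + z i ≠ 0 at hne
      change _ ≤ ‖(k : ℂ) + z i‖
      rw [hm] at hne ⊢
      have hone : (1 : ℝ) ≤ ‖(k : ℂ) + m‖ := by
        have hint : k + m ≠ 0 := by exact_mod_cast hne
        rw [← Int.cast_add, Complex.norm_intCast]
        exact_mod_cast Int.one_le_abs hint
      linarith
end
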